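/- Let (X,d) be a metric space and T a self-map of X satisfying: (i) d(T^n x, T^n y) → 0 for all x, y ∈ X; and (ii) for every x ∈ X and every ε > 0 there exist δ > 0 and a positive integer ν such that for all positive integers p, q, ε < d(T^p x, T^q x) < ε + δ implies d(T^{p+ν} x, T^{q+ν} x) ≤ ε. Then for every x ∈ X the orbit {T^n x} is a Cauchy sequence. -/

import Mathlib

open Filter

/-- Suzuki's theorem: orbits of asymptotic contractions of the final type are Cauchy. -/
theorem stmt15 {X : Type*} [MetricSpace X] (T : X → X)
    (h1 : ∀ x y : X, Tendsto (fun n => dist (T^[n] x) (T^[n] y)) atTop (nhds 0))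
    (h2 : ∀ x : X, ∀ ε : ℝ, 0 < ε → ∃ δ : ℝ, 0 < δ ∧ ∃ ν : ℕ, 0 < ν ∧
        ∀ p q : ℕ, 0 < p → 0 < q →
          ε < dist (T^[p] x) (T^[q] x) → dist (T^[p] x) (T^[q] x) < ε + δ →
          dist (T^[p + ν] x) (T^[q + ν] x) ≤ ε) :
    ∀ x : X, CauchySeq (fun n => T^[n] x) := by
  intro x
  rw [Metric.cauchySeq_iff']
  intro e he
  obtain ⟨δ, hδ, ν, hν, H⟩ := h2 x (e / 3) (by positivity)
  have hs : 0 < min δ (e / 3) := lt_min hδ (by positivity)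
  have hev : ∀ᶠ n in atTop, ∀ j ∈ Finset.range (ν + 1),
      dist (T^[n] x) (T^[n + j] x) < min δ (e / 3) := by
    rw [Filter.eventually_all_finset]
    intro j _
    have h := (h1 x (T^[j] x)).eventually (gt_mem_nhds hs)
    filter_upwards [h] with n hn
    rwa [Function.iterate_add_apply]
  obtain ⟨N, hN⟩ := eventually_atTop.1 hev
  have hd := min_le_left δ (e / 3)
  have hd' := min_le_right δ (e / 3)
  generalize min δ (e / 3) = s at *
  have key : ∀ k : ℕ, dist (T^[N + 1] x) (T^[N + 1 + ν * k] x) < e / 3 + s := by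
    intro k
    induction k with
    | zero => simp; linarith
    | succ k ih =>
      have e1 : N + 1 + ν * (k + 1) = N + 1 + ν * k + ν := by ring
      rw [e1]
      have hmem : ν ∈ Finset.range (ν + 1) := by simp
      rcases le_or_gt (dist (T^[N + 1] x) (T^[N + 1 + ν * k] x)) (e / 3) with h | h
      · have a := hN (N + 1 + ν * k) (by rw [add_assoc]; exact Nat.le_add_right _ _) ν hmem
        have b := dist_triangle (T^[N + 1] x) (T^[N + 1 + ν * k] x) (T^[N + 1 + ν * k + ν] x)
        linarith
      · have a := H (N + 1) (N + 1 + ν * k) (by omega) (by positivity) h (by linarith)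
        have b := hN (N + 1) (by omega) ν hmem
        have c := dist_triangle (T^[N + 1] x) (T^[N + 1 + ν] x) (T^[N + 1 + ν * k + ν] x)
        linarith
  refine ⟨N + 1, fun n hn => ?_⟩
  obtain ⟨m, rfl⟩ := Nat.exists_eq_add_of_le hn
  have hm : N + 1 + m = N + 1 + ν * (m / ν) + m % ν := by
    have := Nat.div_add_mod m ν
    omega
  have a := hN (N + 1 + ν * (m / ν)) (by rw [add_assoc]; exact Nat.le_add_right _ _) (m % ν)
    (by have := Nat.mod_lt m hν; simp; omega)
  have b := key (m / ν)
  rw [← hm] at a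
  have c := dist_triangle (T^[N + 1] x) (T^[N + 1 + ν * (m / ν)] x) (T^[N + 1 + m] x)
  rw [dist_comm]
  linarith
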